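/- In the gSPAWN localization covariance recursion, the covariance matrices converge: for every node i ∈ {1,…,n}, P_i^(l) converges entrywise as l → ∞ to a positive semidefinite Hermitian 2×2 matrix. -/

import Mathlib

open Matrix Filter Topology
open scoped ComplexOrder

/-- The largest eigenvalue of a Hermitian complex matrix (0 for non-Hermitian input). -/
noncomputable def lamMax {d : ℕ} (A : Matrix (Fin d) (Fin d) ℂ) : ℝ :=
  if h : A.IsHermitian then ⨆ k, h.eigenvalues k else 0

open scoped MatrixOrder

theorem Matrix.smul_one_le_smul_one {m : Type*} [DecidableEq m] {a b : ℝ} (h : a ≤ b) :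
    (a : ℂ) • (1 : Matrix m m ℂ) ≤ (b : ℂ) • 1 := by
  rw [Matrix.le_iff, ← sub_smul]
  exact Matrix.PosSemidef.one.smul (sub_nonneg.2 (by exact_mod_cast h))

theorem Matrix.posDef_smul_one {m : Type*} [DecidableEq m] {a : ℝ} (ha : 0 < a) :
    ((a : ℂ) • (1 : Matrix m m ℂ)).PosDef :=
  Matrix.PosDef.one.smul (by exact_mod_cast ha)

section Loewner

variable {m : Type*} [Fintype m] [DecidableEq m]

theorem Matrix.PosDef.inv_le_inv_of_le {A B : Matrix m m ℂ} (hA : A.PosDef) (hB : B.PosDef)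
    (hAB : A ≤ B) : B⁻¹ ≤ A⁻¹ := by
  rw [Matrix.le_iff] at hAB ⊢
  have := hA.isUnit.invertible
  have := hB.isUnit.invertible
  have := hA.inv.isUnit.invertible
  have h₁ := Matrix.PosDef.fromBlocks₁₁ (1 : Matrix m m ℂ) A⁻¹ hB
  have h₂ := Matrix.PosDef.fromBlocks₂₂ B (1 : Matrix m m ℂ) hA.inv
  simp only [conjTranspose_one, Matrix.one_mul, Matrix.mul_one, inv_inv_of_invertible] at h₁ h₂
  exact h₁.1 (h₂.2 hAB)

theorem Matrix.smul_one_inv {a : ℝ} (ha : 0 < a) :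
    ((a : ℂ) • (1 : Matrix m m ℂ))⁻¹ = ((a⁻¹ : ℝ) : ℂ) • 1 := by
  refine Matrix.inv_eq_right_inv ?_
  have : (a : ℂ) ≠ 0 := by exact_mod_cast ha.ne'
  rw [Matrix.smul_mul, Matrix.one_mul, smul_smul, Complex.ofReal_inv, mul_inv_cancel₀ this, one_smul]

theorem Matrix.IsHermitian.le_smul_one {A : Matrix m m ℂ} (hA : A.IsHermitian) {a : ℝ}
    (h : ∀ k, hA.eigenvalues k ≤ a) : A ≤ (a : ℂ) • 1 := by
  have key : (a : ℂ) • (1 : Matrix m m ℂ) - A =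
      Unitary.conjStarAlgAut ℂ _ hA.eigenvectorUnitary
        ((a : ℂ) • 1 - diagonal (RCLike.ofReal ∘ hA.eigenvalues)) := by
    rw [map_sub, ← hA.spectral_theorem, map_smul, map_one]
  rw [Matrix.le_iff, key, Unitary.conjStarAlgAut_apply]
  refine Matrix.PosSemidef.mul_mul_conjTranspose_same ?_ _
  rw [Matrix.smul_one_eq_diagonal, Matrix.diagonal_sub, Matrix.posSemidef_diagonal_iff]
  intro k
  simpa using h k

theorem Matrix.inv_sum_inv_le {ι : Type*} {s : Finset ι} (hs : s.Nonempty)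
    {M : ι → Matrix m m ℂ} (hM : ∀ j ∈ s, (M j).PosDef) {b : ℝ} (hb : 0 < b)
    (hle : ∀ j ∈ s, M j ≤ (b : ℂ) • 1) :
    (∑ j ∈ s, (M j)⁻¹)⁻¹ ≤ ((b / s.card : ℝ) : ℂ) • 1 := by
  have hc : (0 : ℝ) < s.card := by exact_mod_cast hs.card_pos
  have hsum : (((s.card / b : ℝ)) : ℂ) • (1 : Matrix m m ℂ) ≤ ∑ j ∈ s, (M j)⁻¹ := by
    calc (((s.card / b : ℝ)) : ℂ) • (1 : Matrix m m ℂ)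
        = ∑ j ∈ s, ((b : ℂ) • (1 : Matrix m m ℂ))⁻¹ := by
          rw [Matrix.smul_one_inv hb, Finset.sum_const, ← Nat.cast_smul_eq_nsmul ℂ, smul_smul]
          push_cast; rw [div_eq_mul_inv]
      _ ≤ _ := Finset.sum_le_sum fun j hj =>
          (hM j hj).inv_le_inv_of_le (Matrix.posDef_smul_one hb) (hle j hj)
  have := (Matrix.posDef_smul_one (div_pos hc hb)).inv_le_inv_of_le
    (Matrix.posDef_sum hs fun j hj => (hM j hj).inv) hsum
  rwa [Matrix.smul_one_inv (div_pos hc hb), inv_div] at this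

theorem Matrix.inv_sum_inv_mono {ι : Type*} {s : Finset ι} (hs : s.Nonempty)
    {M N : ι → Matrix m m ℂ} (hM : ∀ j ∈ s, (M j).PosDef) (hN : ∀ j ∈ s, (N j).PosDef)
    (hle : ∀ j ∈ s, M j ≤ N j) :
    (∑ j ∈ s, (M j)⁻¹)⁻¹ ≤ (∑ j ∈ s, (N j)⁻¹)⁻¹ :=
  (Matrix.posDef_sum hs fun j hj => (hN j hj).inv).inv_le_inv_of_le
    (Matrix.posDef_sum hs fun j hj => (hM j hj).inv)
    (Finset.sum_le_sum fun j hj => (hM j hj).inv_le_inv_of_le (hN j hj) (hle j hj))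

theorem Matrix.polarization (A : Matrix m m ℂ) (a b : m) :
    A a b = (1 / 2) *
      (star (Pi.single a 1 + Pi.single b 1) ⬝ᵥ A *ᵥ (Pi.single a 1 + Pi.single b 1)
        - Complex.I * (star (Pi.single a 1 + Pi.single b Complex.I) ⬝ᵥ
            A *ᵥ (Pi.single a 1 + Pi.single b Complex.I))
        - (1 - Complex.I) * (star (Pi.single a 1) ⬝ᵥ A *ᵥ Pi.single a 1
            + star (Pi.single b 1) ⬝ᵥ A *ᵥ Pi.single b 1)) := by
  simp only [star_add, Pi.star_single, star_one, Matrix.mulVec_add, add_dotProduct,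
    dotProduct_add, single_dotProduct, Matrix.mulVec_single, Complex.star_def, Complex.conj_I]
  simp
  linear_combination (A a b / 2 - A b a / 2 - Complex.I / 2 * A b b) * Complex.I_sq

theorem Matrix.exists_tendsto_of_antitone {P : ℕ → Matrix m m ℂ} (hP : Antitone P)
    (h0 : ∀ l, (P l).PosSemidef) :
    ∃ Pinf : Matrix m m ℂ, Pinf.PosSemidef ∧
      ∀ a b, Tendsto (fun l => P l a b) atTop (𝓝 (Pinf a b)) := by
  have hq : ∀ x : m → ℂ, ∃ c : ℂ, Tendsto (fun l => star x ⬝ᵥ P l *ᵥ x) atTop (𝓝 c) := by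
    intro x
    have hnn : ∀ l, 0 ≤ star x ⬝ᵥ P l *ᵥ x := fun l => (h0 l).dotProduct_mulVec_nonneg x
    have hanti : Antitone fun l => (star x ⬝ᵥ P l *ᵥ x).re := by
      intro k l hkl
      have := (Matrix.le_iff.1 (hP hkl)).dotProduct_mulVec_nonneg x
      rw [Matrix.sub_mulVec, dotProduct_sub, sub_nonneg] at this
      exact (Complex.le_def.1 this).1
    have hbdd : BddBelow (Set.range fun l => (star x ⬝ᵥ P l *ᵥ x).re) :=
      ⟨0, by rintro _ ⟨l, rfl⟩; exact (Complex.le_def.1 (hnn l)).1⟩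
    refine ⟨_, ((Complex.continuous_ofReal.tendsto _).comp
      (tendsto_atTop_ciInf hanti hbdd)).congr fun l => ?_⟩
    exact Complex.ext rfl (Complex.le_def.1 (hnn l)).2
  choose c hc using hq
  have hlim : ∀ a b, ∃ z : ℂ, Tendsto (fun l => P l a b) atTop (𝓝 z) := fun a b =>
    ⟨_, ((((hc _).sub ((hc _).const_mul _)).sub
      (((hc _).add (hc _)).const_mul _)).const_mul _).congr
      fun l => (Matrix.polarization (P l) a b).symm⟩
  choose Q hQ using hlim
  have hQ' : Tendsto P atTop (𝓝 (Matrix.of Q)) :=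
    tendsto_pi_nhds.2 fun a => tendsto_pi_nhds.2 fun b => hQ a b
  refine ⟨Matrix.of Q, .of_dotProduct_mulVec_nonneg ?_ fun x => ?_, hQ⟩
  · have hcont : Continuous fun A : Matrix m m ℂ => Aᴴ := by fun_prop
    exact tendsto_nhds_unique (((hcont.tendsto _).comp hQ').congr fun l => (h0 l).isHermitian) hQ'
  · have hcont : Continuous fun A : Matrix m m ℂ => star x ⬝ᵥ A *ᵥ x := by fun_prop
    exact ge_of_tendsto' ((hcont.tendsto _).comp hQ') fun l => (h0 l).dotProduct_mulVec_nonneg x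

end Loewner

theorem le_lamMax_smul_one {d : ℕ} {A : Matrix (Fin d) (Fin d) ℂ} (hA : A.IsHermitian) :
    A ≤ (lamMax A : ℂ) • 1 := by
  refine hA.le_smul_one fun k => ?_
  rw [lamMax, dif_pos hA]
  exact le_ciSup (Set.finite_range _).bddAbove k

/-- In a connected graph with root `r`, a non-root node with a single neighbor cannot be adjacent to
a non-root node with a single neighbor. -/
theorem card_ne_one_of_neighbor {V : Type*} {B : V → Finset V} {r i j : V}
    (hsym : ∀ i j, j ∈ B i ↔ i ∈ B j)
    (hconn : ∀ i j, Relation.ReflTransGen (fun a b => b ∈ B a) i j)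
    (hi : i ≠ r) (hj : j ≠ r) (hij : j ∈ B i) (hci : (B i).card = 1) : (B j).card ≠ 1 := by
  intro hcj
  obtain ⟨x, hx⟩ := Finset.card_eq_one.1 hci
  obtain ⟨y, hy⟩ := Finset.card_eq_one.1 hcj
  have hji := (hsym i j).1 hij
  have hclosed : ∀ k, Relation.ReflTransGen (fun a b => b ∈ B a) i k → k = i ∨ k = j := by
    intro k hk
    induction hk with
    | refl => exact .inl rfl
    | tail _ hbc ih =>
      simp only [hx, hy, Finset.mem_singleton] at hij hji
      rcases ih with rfl | rfl
      · simp only [hx, Finset.mem_singleton] at hbc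
        exact .inr (hbc.trans hij.symm)
      · simp only [hy, Finset.mem_singleton] at hbc
        exact .inl (hbc.trans hji.symm)
  rcases hclosed r (hconn i r) with h | h
  · exact hi h.symm
  · exact hj h.symm

/-- In the gSPAWN localization covariance recursion (the case `G = H̄ = I₂`), the
covariance matrices converge entrywise to positive semidefinite Hermitian matrices. -/
theorem stmt_14 {n : ℕ}
    (B : Fin (n + 1) → Finset (Fin (n + 1)))
    (hsym : ∀ i j : Fin (n + 1), j ∈ B i ↔ i ∈ B j)
    (hne : ∀ i : Fin (n + 1), i ≠ 0 → (B i).Nonempty)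
    (hconn : ∀ i j : Fin (n + 1), Relation.ReflTransGen (fun a b => b ∈ B a) i j)
    (C : Fin (n + 1) → Fin (n + 1) → Matrix (Fin 2) (Fin 2) ℂ)
    (hC : ∀ i : Fin (n + 1), i ≠ 0 → ∀ j ∈ B i, (C i j).PosDef)
    (α α₀ : ℝ) (hαpos : 0 < α) (hα₀ : 0 ≤ α₀) (hαα₀ : α₀ ≤ α)
    (hαC : ∀ i : Fin (n + 1), i ≠ 0 → ∀ j ∈ B i, lamMax (C i j) ≤ α)
    (P : ℕ → Fin (n + 1) → Matrix (Fin 2) (Fin 2) ℂ)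
    (hP0 : ∀ l, P l 0 = (α₀ : ℂ) • 1)
    (hPinit : ∀ i : Fin (n + 1), i ≠ 0 → P 0 i =
      (if (B i).card = 1 then ((4 * α : ℝ) : ℂ)
       else if (B i).card = 2 then ((3 * α : ℝ) : ℂ)
       else ((5 * α / 3 : ℝ) : ℂ)) • 1)
    (hPrec : ∀ l, ∀ i : Fin (n + 1), i ≠ 0 →
      P (l + 1) i = (∑ j ∈ B i, (C i j + P l j)⁻¹)⁻¹) :
    ∀ i : Fin (n + 1), i ≠ 0 → ∃ Pinf : Matrix (Fin 2) (Fin 2) ℂ,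
      Pinf.PosSemidef ∧ ∀ a b, Tendsto (fun l => P l i a b) atTop (𝓝 (Pinf a b)) := by
  have hCle : ∀ i : Fin (n + 1), i ≠ 0 → ∀ j ∈ B i, C i j ≤ (α : ℂ) • 1 := fun i hi j hj =>
    (le_lamMax_smul_one (hC i hi j hj).isHermitian).trans
      (Matrix.smul_one_le_smul_one (hαC i hi j hj))
  have hroot : ((α₀ : ℂ) • (1 : Matrix (Fin 2) (Fin 2) ℂ)).PosSemidef :=
    Matrix.PosSemidef.one.smul (by exact_mod_cast hα₀)
  have hinit : ∀ i : Fin (n + 1), i ≠ 0 → P 0 i = ((if (B i).card = 1 then 4 * α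
      else if (B i).card = 2 then 3 * α else 5 * α / 3 : ℝ) : ℂ) • 1 := by
    intro i hi
    rw [hPinit i hi]
    split_ifs <;> rfl
  have hpsd : ∀ l i, (P l i).PosSemidef := by
    intro l
    induction l with
    | zero =>
      intro i
      rcases eq_or_ne i 0 with rfl | hi
      · rw [hP0]; exact hroot
      · rw [hinit i hi]
        refine (Matrix.posDef_smul_one ?_).posSemidef
        split_ifs <;> positivity
    | succ l ih =>
      intro i
      rcases eq_or_ne i 0 with rfl | hi
      · rw [hP0]; exact hroot
      · rw [hPrec l i hi]
        exact (Matrix.posDef_sum (hne i hi)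
          fun j hj => ((hC i hi j hj).add_posSemidef (ih j)).inv).inv.posSemidef
  have hpd : ∀ l i, i ≠ 0 → ∀ j ∈ B i, (C i j + P l j).PosDef := fun l i hi j hj =>
    (hC i hi j hj).add_posSemidef (hpsd l j)
  have hfour : ∀ j, P 0 j ≤ ((4 * α : ℝ) : ℂ) • 1 := by
    intro j
    rcases eq_or_ne j 0 with rfl | hj
    · rw [hP0]; exact Matrix.smul_one_le_smul_one (by linarith)
    · rw [hinit j hj]
      refine Matrix.smul_one_le_smul_one ?_
      split_ifs <;> linarith
  have hbound : ∀ i : Fin (n + 1), i ≠ 0 → ∀ b : ℝ, 0 ≤ b →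
      (∀ j ∈ B i, P 0 j ≤ (b : ℂ) • 1) →
      P 1 i ≤ (((α + b) / (B i).card : ℝ) : ℂ) • 1 := by
    intro i hi b hb h
    rw [hPrec 0 i hi]
    refine Matrix.inv_sum_inv_le (hne i hi) (hpd 0 i hi) (by linarith) fun j hj => ?_
    rw [Complex.ofReal_add, add_smul]
    exact add_le_add (hCle i hi j hj) (h j hj)
  have hstep : ∀ i, P 1 i ≤ P 0 i := by
    intro i
    rcases eq_or_ne i 0 with rfl | hi
    · rw [hP0, hP0]
    · rw [hinit i hi]
      by_cases h1 : (B i).card = 1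
      · refine (hbound i hi (3 * α) (by positivity) fun j hj => ?_).trans
          (Matrix.smul_one_le_smul_one ?_)
        · rcases eq_or_ne j 0 with rfl | hj0
          · rw [hP0]; exact Matrix.smul_one_le_smul_one (by linarith)
          · rw [hinit j hj0, if_neg (card_ne_one_of_neighbor hsym hconn hi hj0 hj h1)]
            refine Matrix.smul_one_le_smul_one ?_
            split_ifs <;> linarith
        · rw [if_pos h1, h1, Nat.cast_one]; linarith
      · refine (hbound i hi (4 * α) (by positivity) fun j _ => hfour j).trans
          (Matrix.smul_one_le_smul_one ?_)
        rw [if_neg h1]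
        split_ifs with h2
        · rw [h2, Nat.cast_ofNat]; linarith
        · have hpos := (hne i hi).card_pos
          have h3 : (3 : ℝ) ≤ (B i).card := by
            exact_mod_cast (by omega : 3 ≤ (B i).card)
          calc (α + 4 * α) / (B i).card ≤ (α + 4 * α) / 3 := by gcongr
            _ = 5 * α / 3 := by ring
  have hmono : ∀ l i, P (l + 1) i ≤ P l i := by
    intro l
    induction l with
    | zero => exact hstep
    | succ l ih =>
      intro i
      rcases eq_or_ne i 0 with rfl | hi
      · rw [hP0, hP0]
      · rw [hPrec (l + 1) i hi, hPrec l i hi]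
        exact Matrix.inv_sum_inv_mono (hne i hi) (hpd (l + 1) i hi) (hpd l i hi)
          fun j _ => by gcongr; exact ih j
  intro i _
  exact Matrix.exists_tendsto_of_antitone (P := fun l => P l i)
    (antitone_nat_of_succ_le fun l => hmono l i) fun l => hpsd l i
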